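/- arXiv:1404.0654 — 2 statements merged into one kernel-verified Lean document; each statement's English description precedes it below -/
import Mathlib

section
/- There exists a universal constant α > 0 such that the following holds for all n and every integer d ≥ 1. Let f : F_2^n → F_2 be a polynomial of total degree at most d. Then there exists an integer k with k ≥ α · n^{1/(d-1)!} such that for every β ∈ F_2^n, the integer Σ_{x ∈ F_2^n} (-1)^{⟨β,x⟩ + f(x)} is divisible by 2^k; equivalently, every Fourier coefficient of f is an integer multiple of 2^{k-n}. -/
open MvPolynomial

/-- The nontrivial additive character of `ZMod 2`, with integer values. -/
def binarySign (a : ZMod 2) : ℤ := if a = 0 then 1 else -1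

theorem binarySign_add (a b : ZMod 2) :
    binarySign (a + b) = binarySign a * binarySign b := by
  revert a b; decide

theorem binarySign_sum {ι : Type*} (s : Finset ι) (a : ι → ZMod 2) :
    binarySign (∑ i ∈ s, a i) = ∏ i ∈ s, binarySign (a i) := by
  classical
  induction s using Finset.induction_on with
  | empty => rfl
  | insert i s hi ih => rw [Finset.sum_insert hi, Finset.prod_insert hi, binarySign_add, ih]

theorem prod_pow_eq_ite {n : ℕ} (m : Fin n →₀ ℕ) (x : Fin n → ZMod 2) :
    (m.prod fun i e => x i ^ e) = if ∀ i ∈ m.support, x i = 1 then 1 else 0 := by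
  have h01 : ∀ a : ZMod 2, a ≠ 1 → a = 0 := by decide
  split_ifs with h
  · exact Finset.prod_eq_one fun i hi => by simp only [h i hi, one_pow]
  · push Not at h
    obtain ⟨i, hi, hx⟩ := h
    exact Finset.prod_eq_zero hi
      (by simp only [h01 _ hx, zero_pow (Finsupp.mem_support_iff.mp hi)])

theorem binarySign_eval {n : ℕ} (f : MvPolynomial (Fin n) (ZMod 2)) (x : Fin n → ZMod 2) :
    binarySign (eval x f) =
      ∏ m ∈ f.support, (1 + -2 * (if ∀ i ∈ m.support, x i = 1 then 1 else 0)) := by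
  have h01 : ∀ a : ZMod 2, a ≠ 0 → a = 1 := by decide
  rw [eval_eq, binarySign_sum]
  refine Finset.prod_congr rfl fun m hm => ?_
  have hp := prod_pow_eq_ite m x
  rw [Finsupp.prod] at hp
  rw [h01 _ (mem_support_iff.mp hm), one_mul, hp]
  split_ifs <;> rfl

/-- The number of points of a subcube of `(ZMod 2) ^ n`, as a sum of indicators. -/
theorem sum_ite_forall_mem_eq_one {n : ℕ} (U : Finset (Fin n)) :
    ∑ x : Fin n → ZMod 2, (if ∀ i ∈ U, x i = 1 then (1 : ℤ) else 0) = 2 ^ (n - U.card) := by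
  classical
  have h : ∀ x : Fin n → ZMod 2, (if ∀ i ∈ U, x i = 1 then (1 : ℤ) else 0) =
      ∏ i, if i ∈ U → x i = 1 then 1 else 0 := by
    intro x
    rw [Finset.prod_ite_zero]
    simp
  simp_rw [h]
  rw [← Fintype.prod_sum fun i (a : ZMod 2) => if i ∈ U → a = 1 then (1 : ℤ) else 0]
  have h2 : ∀ i, ∑ a : ZMod 2, (if i ∈ U → a = 1 then (1 : ℤ) else 0) =
      if i ∈ U then 1 else 2 := by
    intro i
    by_cases hi : i ∈ U <;> simp [hi]
  simp_rw [h2]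
  rw [Finset.prod_ite, Finset.prod_const_one, one_mul, Finset.prod_const,
    Finset.filter_not, Finset.filter_mem_eq_inter, Finset.univ_inter,
    Finset.card_sdiff_of_subset (Finset.subset_univ U), Finset.card_univ, Fintype.card_fin]

/-- McEliece's divisibility theorem for Reed–Muller codes. -/
theorem two_pow_dvd_sum_binarySign_eval {n d k : ℕ} (hk : ∀ s, k ≤ s + (n - d * s))
    (f : MvPolynomial (Fin n) (ZMod 2)) (hf : f.totalDegree ≤ d) :
    (2 : ℤ) ^ k ∣ ∑ x : Fin n → ZMod 2, binarySign (eval x f) := by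
  classical
  simp_rw [binarySign_eval, Finset.prod_one_add]
  rw [Finset.sum_comm]
  refine Finset.dvd_sum fun S hS => ?_
  have hcard : (S.biUnion Finsupp.support).card ≤ d * S.card := by
    rw [mul_comm]
    refine Finset.card_biUnion_le_card_mul _ _ _ fun m hm => ?_
    refine le_trans ?_ ((le_totalDegree (Finset.mem_powerset.mp hS hm)).trans hf)
    rw [Finset.card_eq_sum_ones]
    exact Finset.sum_le_sum fun i hi => Nat.one_le_iff_ne_zero.mpr (Finsupp.mem_support_iff.mp hi)
  have hterm : ∀ x : Fin n → ZMod 2,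
      (∏ m ∈ S, (-2 * (if ∀ i ∈ m.support, x i = 1 then 1 else 0) : ℤ)) =
        (-2) ^ S.card * if ∀ i ∈ S.biUnion Finsupp.support, x i = 1 then 1 else 0 := by
    intro x
    rw [Finset.prod_mul_distrib, Finset.prod_const, Finset.prod_ite_zero, Finset.prod_const_one]
    congr 2
    simp only [Finset.mem_biUnion]
    exact propext ⟨fun h i ⟨m, hm, hi⟩ => h m hm i hi, fun h m hm i hi => h i ⟨m, hm, hi⟩⟩
  simp_rw [hterm]
  rw [← Finset.mul_sum, sum_ite_forall_mem_eq_one, neg_pow, mul_assoc, ← pow_add]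
  refine Dvd.dvd.mul_left (pow_dvd_pow _ ((hk S.card).trans ?_)) _
  omega

theorem ceilDiv_le_add_sub_mul {n d : ℕ} (hd : 1 ≤ d) (s : ℕ) :
    n ⌈/⌉ d ≤ s + (n - d * s) := by
  rw [ceilDiv_le_iff_le_mul (by omega)]
  obtain h | h := le_total n (d * s)
  · nlinarith
  · obtain ⟨r, rfl⟩ := Nat.exists_eq_add_of_le h
    rw [Nat.add_sub_cancel_left]
    nlinarith

theorem rpow_one_div_factorial_le (n d : ℕ) (hd : 1 ≤ d) :
    (1 / 2 : ℝ) * (n : ℝ) ^ ((1 : ℝ) / (Nat.factorial (d - 1) : ℝ)) ≤ ((n ⌈/⌉ d : ℕ) : ℝ) := by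
  have hd' : (0 : ℝ) < d := by exact_mod_cast hd
  have hm : (1 : ℝ) ≤ Nat.factorial (d - 1) := by exact_mod_cast Nat.factorial_pos _
  set m := Nat.factorial (d - 1)
  have he0 : (0 : ℝ) < 1 / m := by positivity
  have he1 : (1 : ℝ) / m ≤ 1 := by rw [div_le_one (by positivity)]; exact hm
  have hd2 : (d : ℝ) ^ ((1 : ℝ) / m) ≤ 2 := by
    have h1 : d ≤ 2 ^ m := by
      have h2 : d - 1 < 2 ^ (d - 1) := Nat.lt_two_pow_self
      have h3 : 2 ^ (d - 1) ≤ 2 ^ m := Nat.pow_le_pow_right (by norm_num) (Nat.self_le_factorial _)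
      omega
    calc (d : ℝ) ^ ((1 : ℝ) / m) ≤ ((2 : ℝ) ^ m) ^ ((1 : ℝ) / m) :=
          Real.rpow_le_rpow hd'.le (by exact_mod_cast h1) he0.le
      _ = 2 := by
          rw [one_div, Real.pow_rpow_inv_natCast (by norm_num) (Nat.factorial_ne_zero _)]
  have hk : n ≤ d * (n ⌈/⌉ d) := (ceilDiv_le_iff_le_mul (by omega)).mp le_rfl
  have hk' : (n : ℝ) / d ≤ ((n ⌈/⌉ d : ℕ) : ℝ) := by
    rw [div_le_iff₀' hd']; exact_mod_cast hk
  obtain rfl | hn := Nat.eq_zero_or_pos n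
  · rw [Nat.cast_zero, Real.zero_rpow he0.ne', mul_zero]
    positivity
  obtain h | h := le_total n d
  · have h1 : 1 ≤ n ⌈/⌉ d := by
      by_contra h0
      have : n ⌈/⌉ d = 0 := by omega
      rw [this] at hk
      omega
    have h1' : (1 : ℝ) ≤ ((n ⌈/⌉ d : ℕ) : ℝ) := by exact_mod_cast h1
    have := Real.rpow_le_rpow n.cast_nonneg (Nat.cast_le (α := ℝ).mpr h) he0.le
    linarith
  · have h1 : (1 : ℝ) ≤ n / d := by rw [one_le_div hd']; exact_mod_cast h
    have h2 : ((n : ℝ) / d) ^ ((1 : ℝ) / m) ≤ n / d := by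
      simpa using Real.rpow_le_rpow_of_exponent_le h1 he1
    have h3 : (n : ℝ) ^ ((1 : ℝ) / m) = (d : ℝ) ^ ((1 : ℝ) / m) * ((n : ℝ) / d) ^ ((1 : ℝ) / m) := by
      rw [← Real.mul_rpow hd'.le (by positivity), mul_div_cancel₀ _ hd'.ne']
    have h4 : (d : ℝ) ^ ((1 : ℝ) / m) * ((n : ℝ) / d) ^ ((1 : ℝ) / m) ≤ 2 * (n / d) :=
      mul_le_mul hd2 h2 (by positivity) (by norm_num)
    linarith

theorem stmt_18 : ∃ α : ℝ, 0 < α ∧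
    ∀ (n d : ℕ), 1 ≤ d →
    ∀ f : MvPolynomial (Fin n) (ZMod 2), f.totalDegree ≤ d →
    ∃ k : ℕ, α * (n : ℝ) ^ ((1 : ℝ) / (Nat.factorial (d - 1) : ℝ)) ≤ (k : ℝ) ∧
      ∀ β : Fin n → ZMod 2,
        ((2 : ℤ) ^ k) ∣ ∑ x : Fin n → ZMod 2,
          (if (∑ i, β i * x i) + eval x f = 0 then (1 : ℤ) else -1) := by
  refine ⟨1 / 2, by norm_num, fun n d hd f hf =>
    ⟨n ⌈/⌉ d, rpow_one_div_factorial_le n d hd, fun β => ?_⟩⟩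
  have hdeg : ((∑ i, C (β i) * X i) + f).totalDegree ≤ d := by
    refine (totalDegree_add _ _).trans (max_le ?_ hf)
    refine (totalDegree_finsetSum_le fun i _ => ?_).trans hd
    refine (totalDegree_mul _ _).trans ?_
    rw [totalDegree_C, totalDegree_X]
  simpa [binarySign] using two_pow_dvd_sum_binarySign_eval (ceilDiv_le_add_sub_mul hd) _ hdeg
end

section
/- For all integers n and k with 2 ≤ k ≤ n, there exists a family of m = n·k matrices A₁, …, A_m, each of size (k+1) × n with entries in F_2, such that for every linear subspace U ⊆ F_2^n of dimension k, there exists an index i ∈ {1,…,m} with ker(A_i) ∩ U = {0}; that is, the linear map x ↦ A_i x is injective on U. -/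
open Finset in
/-- Union bound: if each of at most `q ^ M` bad sets has density less than `1 / q`, then some
`M`-tuple escapes every bad set in at least one coordinate. -/
theorem exists_tuple_forall_exists_notMem {α T : Type*} [Fintype α] [Nonempty α] [Fintype T]
    {q M : ℕ} (hM : M ≠ 0) (hT : Fintype.card T ≤ q ^ M) (bad : T → Finset α)
    (hbad : ∀ t, q * #(bad t) < Fintype.card α) :
    ∃ f : Fin M → α, ∀ t, ∃ i, f i ∉ bad t := by
  classical
  by_contra! h
  have hcover : (univ : Finset (Fin M → α)) ⊆
      univ.biUnion fun t => Fintype.piFinset fun _ => bad t := fun f _ => by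
    obtain ⟨t, ht⟩ := h f
    exact mem_biUnion.2 ⟨t, mem_univ t, Fintype.mem_piFinset.2 ht⟩
  have hle : Fintype.card α ^ M ≤ ∑ t, #(bad t) ^ M := by
    simpa using (card_le_card hcover).trans card_biUnion_le
  have hT' : (univ : Finset T).Nonempty := by
    obtain ⟨t, -⟩ := h fun _ => Classical.arbitrary α
    exact ⟨t, mem_univ t⟩
  have hlt : ∑ t, (q * #(bad t)) ^ M < ∑ _t : T, Fintype.card α ^ M :=
    sum_lt_sum_of_nonempty hT' fun t _ => Nat.pow_lt_pow_left (hbad t) hM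
  have := calc
    q ^ M * Fintype.card α ^ M ≤ q ^ M * ∑ t, #(bad t) ^ M := Nat.mul_le_mul_left _ hle
    _ = ∑ t, (q * #(bad t)) ^ M := by simp only [mul_sum, mul_pow]
    _ < ∑ _t : T, Fintype.card α ^ M := hlt
    _ = Fintype.card T * Fintype.card α ^ M := by simp
    _ ≤ q ^ M * Fintype.card α ^ M := Nat.mul_le_mul_right _ hT
  exact this.false

section FiniteField

variable {F : Type*} [Field F] [Fintype F] [DecidableEq F]

open Finset in
/-- The `m × n` matrices killing a fixed nonzero vector have density `|F| ^ (-m)`. -/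
theorem card_matrix_mulVec_eq_zero_mul {m n : ℕ} {x : Fin n → F} (hx : x ≠ 0) :
    #{A : Matrix (Fin m) (Fin n) F | A.mulVec x = 0} * Fintype.card F ^ m =
      Fintype.card (Matrix (Fin m) (Fin n) F) := by
  let φ : Matrix (Fin m) (Fin n) F →+ (Fin m → F) :=
    { toFun := fun A => A.mulVec x
      map_zero' := Matrix.zero_mulVec x
      map_add' := fun A B => Matrix.add_mulVec A B x }
  have hφ : Function.Surjective φ := fun y => by
    obtain ⟨j, hj⟩ := Function.ne_iff.1 hx
    refine ⟨Matrix.vecMulVec y (Pi.single j (x j)⁻¹), ?_⟩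
    change (Matrix.vecMulVec y (Pi.single j (x j)⁻¹)).mulVec x = y
    have hj' : x j ≠ 0 := hj
    simp [Matrix.vecMulVec_mulVec, hj']
  have hker : Nat.card φ.ker = #{A : Matrix (Fin m) (Fin n) F | A.mulVec x = 0} := by
    rw [← Fintype.card_subtype, ← Nat.card_eq_fintype_card]
    rfl
  have hindex : φ.ker.index = Fintype.card F ^ m := by
    rw [AddSubgroup.index_ker, AddMonoidHom.range_eq_top.2 hφ, AddSubgroup.card_top]
    simp
  rw [← hker, ← hindex, AddSubgroup.card_mul_index, Nat.card_eq_fintype_card]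

open Finset in
/-- For `U` of dimension `k`, the `(k + 1) × n` matrices that are not injective on `U` have
density less than `1 / |F|`. -/
theorem card_mul_card_matrix_not_injOn_lt {n k : ℕ} (U : Submodule F (Fin n → F))
    (hU : Module.finrank F U = k)
    [DecidablePred fun A : Matrix (Fin (k + 1)) (Fin n) F => ∃ x ∈ U, A.mulVec x = 0 ∧ x ≠ 0] :
    Fintype.card F * #{A : Matrix (Fin (k + 1)) (Fin n) F | ∃ x ∈ U, A.mulVec x = 0 ∧ x ≠ 0} <
      Fintype.card (Matrix (Fin (k + 1)) (Fin n) F) := by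
  classical
  set N := Fintype.card (Matrix (Fin (k + 1)) (Fin n) F)
  set q := Fintype.card F
  set S : Finset (Fin n → F) := {x | x ∈ U}
  have hS : #S = q ^ k := by
    rw [← Fintype.card_subtype, ← hU, ← Module.card_eq_pow_finrank (K := F) (V := U)]
  have hS' : #(S.erase 0) < q ^ k := hS ▸ card_erase_lt_of_mem (by simp [S])
  have hcover : ({A | ∃ x ∈ U, A.mulVec x = 0 ∧ x ≠ 0} :
      Finset (Matrix (Fin (k + 1)) (Fin n) F)) ⊆
      (S.erase 0).biUnion fun x => {A | A.mulVec x = 0} := fun A hA => by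
    obtain ⟨x, hxU, hAx, hx⟩ := (mem_filter.1 hA).2
    exact mem_biUnion.2 ⟨x, by simp [S, hx, hxU], by simpa using hAx⟩
  have hle := (card_le_card hcover).trans card_biUnion_le
  have hN : 0 < N := Fintype.card_pos
  refine Nat.lt_of_mul_lt_mul_left (a := q ^ k) ?_
  calc
    _ = #{A : Matrix (Fin (k + 1)) (Fin n) F | ∃ x ∈ U, A.mulVec x = 0 ∧ x ≠ 0} *
        q ^ (k + 1) := by ring
    _ ≤ (∑ x ∈ S.erase 0, #{A : Matrix (Fin (k + 1)) (Fin n) F | A.mulVec x = 0}) *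
        q ^ (k + 1) := Nat.mul_le_mul_right _ hle
    _ = ∑ x ∈ S.erase 0, N := by
      rw [sum_mul]
      exact sum_congr rfl fun x hx => card_matrix_mulVec_eq_zero_mul (ne_of_mem_erase hx)
    _ = #(S.erase 0) * N := by simp
    _ < q ^ k * N := Nat.mul_lt_mul_of_pos_right hS' hN

end FiniteField

/-- There are at most `|V| ^ k` subspaces of dimension `k`. -/
theorem card_submodule_finrank_eq_le {F V : Type*} [Field F] [AddCommGroup V] [Module F V]
    [Fintype V] (k : ℕ) [Fintype {U : Submodule F V // Module.finrank F U = k}] :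
    Fintype.card {U : Submodule F V // Module.finrank F U = k} ≤ Fintype.card V ^ k := by
  let b (U : {U : Submodule F V // Module.finrank F U = k}) :=
    Module.finBasisOfFinrankEq F U.1 U.2
  have hspan (U : {U : Submodule F V // Module.finrank F U = k}) :
      Submodule.span F (Set.range fun i => (b U i : V)) = U := by
    rw [Set.range_comp' Subtype.val, ← Submodule.coe_subtype, Submodule.span_image,
      (b U).span_eq, Submodule.map_top, Submodule.range_subtype]
  have hinj : Function.Injective fun U (i : Fin k) => (b U i : V) := fun U W h => by
    refine Subtype.ext ?_
    rw [← hspan U, ← hspan W]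
    exact congrArg (fun v : Fin k → V => Submodule.span F (Set.range v)) h
  simpa using Fintype.card_le_of_injective _ hinj

theorem stmt_19 (n k : ℕ) (hk : 2 ≤ k) (hkn : k ≤ n) :
    ∃ A : Fin (n * k) → Matrix (Fin (k + 1)) (Fin n) (ZMod 2),
      ∀ U : Submodule (ZMod 2) (Fin n → ZMod 2), Module.finrank (ZMod 2) ↥U = k →
        ∃ i, ∀ x ∈ U, (A i).mulVec x = 0 → x = 0 := by
  classical
  let T := {U : Submodule (ZMod 2) (Fin n → ZMod 2) // Module.finrank (ZMod 2) U = k}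
  have : Fintype T := Fintype.ofFinite T
  have hT : Fintype.card T ≤ 2 ^ (n * k) := by
    simpa [pow_mul] using card_submodule_finrank_eq_le (F := ZMod 2) (V := Fin n → ZMod 2) k
  obtain ⟨A, hA⟩ := exists_tuple_forall_exists_notMem (Nat.mul_ne_zero (by omega) (by omega)) hT
    (fun U => ({A | ∃ x ∈ U.1, A.mulVec x = 0 ∧ x ≠ 0} :
      Finset (Matrix (Fin (k + 1)) (Fin n) (ZMod 2))))
    (fun U => by simpa only [ZMod.card] using card_mul_card_matrix_not_injOn_lt U.1 U.2)
  refine ⟨A, fun U hU => ?_⟩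
  obtain ⟨i, hi⟩ := hA ⟨U, hU⟩
  refine ⟨i, fun x hx hAx => by_contra fun h => hi ?_⟩
  exact Finset.mem_filter.2 ⟨Finset.mem_univ _, x, hx, hAx, h⟩
end
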